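/- For every integer k ≥ 1, letting δ_k denote the decreasing permutation k(k−1)⋯21 of length k, the class Av(δ_k) possesses a proper growth rate and gr(Av(δ_k)) = (k−1)²; that is, lim_{n→∞} |Av(δ_k)_n|^{1/n} = (k−1)². -/

import Mathlib

open Filter Topology ENNReal

/-- A permutation of length `n`, in one-line notation `π 0, π 1, …, π (n-1)`. -/
abbrev Perm (n : ℕ) := Equiv.Perm (Fin n)

/-- `Pattern σ π` : the permutation `σ` is contained in `π`, i.e. some subsequence of `π`
is order isomorphic to `σ`. -/
def Pattern {k n : ℕ} (σ : Perm k) (π : Perm n) : Prop :=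
  ∃ f : Fin k ↪o Fin n, ∀ i j : Fin k, σ i < σ j ↔ π (f i) < π (f j)

/-- A permutation class: a set of permutations closed downwards under containment. -/
structure PermClass where
  mem : ∀ n, Set (Perm n)
  closed : ∀ {k n : ℕ} (σ : Perm k) (π : Perm n), π ∈ mem n → Pattern σ π → σ ∈ mem k

/-- The entries of `π` at the positions in `A` form a sequence order isomorphic
to a member of the family `F`. -/
def SubpermIn {n : ℕ} (π : Perm n) (A : Set (Fin n)) (F : ∀ m, Set (Perm m)) : Prop :=
  ∃ (m : ℕ) (σ : Perm m) (f : Fin m ↪o Fin n),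
    Set.range ⇑f = A ∧ (∀ i j : Fin m, σ i < σ j ↔ π (f i) < π (f j)) ∧ σ ∈ F m

/-- The merge `C ⊙ D`: permutations whose entries can be partitioned into a subsequence
order isomorphic to a member of `C` and one order isomorphic to a member of `D`. -/
def mergeSet (C D : ∀ m, Set (Perm m)) (n : ℕ) : Set (Perm n) :=
  {π | ∃ A : Set (Fin n), SubpermIn π A C ∧ SubpermIn π Aᶜ D}

/-- `|F_n| ^ (1/n)` as a real number. -/
noncomputable def growthSeq (F : ∀ m, Set (Perm m)) (n : ℕ) : ℝ :=
  ((F n).ncard : ℝ) ^ ((n : ℝ)⁻¹)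

/-- The family `F` has (finite) proper growth rate `g`. -/
def HasGrowth (F : ∀ m, Set (Perm m)) (g : ℝ) : Prop :=
  Tendsto (growthSeq F) atTop (𝓝 g)

/-- `|F_n| ^ (1/n)` in the extended nonnegative reals. -/
noncomputable def eGrowthSeq (F : ∀ m, Set (Perm m)) (n : ℕ) : ℝ≥0∞ :=
  ((F n).ncard : ℝ≥0∞) ^ ((n : ℝ)⁻¹)

/-- The upper growth rate `limsup |F_n|^(1/n)`. -/
noncomputable def ugr (F : ∀ m, Set (Perm m)) : ℝ≥0∞ := limsup (eGrowthSeq F) atTop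

/-- The lower growth rate `liminf |F_n|^(1/n)`. -/
noncomputable def lgr (F : ∀ m, Set (Perm m)) : ℝ≥0∞ := liminf (eGrowthSeq F) atTop

/-- The direct sum `π ⊕ σ` of two permutations. -/
def dsum {m n : ℕ} (π : Perm m) (σ : Perm n) : Perm (m + n) :=
  finSumFinEquiv.symm.trans ((Equiv.sumCongr π σ).trans finSumFinEquiv)

/-- The skew sum `π ⊖ σ` of two permutations. -/
def skewSum {m n : ℕ} (π : Perm m) (σ : Perm n) : Perm (m + n) :=
  finSumFinEquiv.symm.trans ((Equiv.sumCongr π σ).trans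
    (((Equiv.sumComm (Fin m) (Fin n)).trans finSumFinEquiv).trans (finCongr (Nat.add_comm n m))))

/-- A family of permutations is sum closed if it is closed under `⊕`. -/
def SumClosed (F : ∀ m, Set (Perm m)) : Prop :=
  ∀ {m n : ℕ} (π : Perm m) (σ : Perm n), π ∈ F m → σ ∈ F n → dsum π σ ∈ F (m + n)

/-- A family of permutations is skew closed if it is closed under `⊖`. -/
def SkewClosed (F : ∀ m, Set (Perm m)) : Prop :=
  ∀ {m n : ℕ} (π : Perm m) (σ : Perm n), π ∈ F m → σ ∈ F n → skewSum π σ ∈ F (m + n)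

/-- The class of an empty (blocked) grid cell: only the empty permutation. -/
def emptyCell : ∀ m, Set (Perm m) := fun m => {_π | m = 0}

/-- The set of positions of `π` lying in column `k` and row `ℓ` of the gridding
determined by the column divisions `c` and row divisions `r`. -/
def cellSet {n : ℕ} (π : Perm n) (c r : ℕ → ℕ) (k ℓ : ℕ) : Set (Fin n) :=
  {i | c k ≤ (i : ℕ) ∧ (i : ℕ) < c (k + 1) ∧ r ℓ ≤ (π i : ℕ) ∧ (π i : ℕ) < r (ℓ + 1)}

/-- The grid class of an (infinite) matrix `M` of families of permutations, where
`M k ℓ` is the cell in column `k`, row `ℓ` (Cartesian coordinates, indexed from 0). -/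
def gridSet (M : ℕ → ℕ → ∀ m, Set (Perm m)) (n : ℕ) : Set (Perm n) :=
  {π | ∃ c r : ℕ → ℕ, Monotone c ∧ Monotone r ∧ c 0 = 0 ∧ r 0 = 0 ∧
    (∀ k, c k ≤ n) ∧ (∀ ℓ, r ℓ ≤ n) ∧ (∃ k, c k = n) ∧ (∃ ℓ, r ℓ = n) ∧
    ∀ k ℓ, cellSet π c r k ℓ = ∅ ∨ SubpermIn π (cellSet π c r k ℓ) (M k ℓ)}

/-- The matrix of the infinite increasing `(C, D)` staircase: cell in column `i`, row `i`
is `C`, cell in column `i+1`, row `i` is `D`, all other cells empty. -/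
def incStairM (C D : ∀ m, Set (Perm m)) : ℕ → ℕ → ∀ m, Set (Perm m) :=
  fun k ℓ => if k = ℓ then C else if k = ℓ + 1 then D else emptyCell

/-- The decreasing permutation `k (k-1) ⋯ 2 1` of length `k`. -/
def delta (k : ℕ) : Perm k := ⟨Fin.rev, Fin.rev, Fin.rev_rev, Fin.rev_rev⟩

/-- The class of permutations avoiding the pattern `τ`. -/
def avSet {k : ℕ} (τ : Perm k) : ∀ n, Set (Perm n) := fun n => {π | ¬ Pattern τ π}

/-- The shape of an infinite `(C,D)` staircase: `pos j` is the (column, row) position of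
the `(j+1)`-st cell; odd-indexed steps share a row with their predecessor, even-indexed
steps share a column with their predecessor, and no other sharing of rows or columns occurs. -/
structure StaircaseData where
  pos : ℕ → ℕ × ℕ
  inj : Function.Injective pos
  rowEq : ∀ i, (pos (2 * i + 1)).2 = (pos (2 * i)).2
  colEq : ∀ i, (pos (2 * i + 2)).1 = (pos (2 * i + 1)).1
  rowOnly : ∀ j j', (pos j).2 = (pos j').2 → j / 2 = j' / 2
  colOnly : ∀ j j', (pos j).1 = (pos j').1 → (j + 1) / 2 = (j' + 1) / 2

open Classical in
/-- The matrix of the infinite `(C,D)` staircase with shape `S`: the odd-numbered cells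
(cells `1, 3, 5, …`, i.e. `pos 0, pos 2, …`) are `C`, the even-numbered cells are `D`. -/
noncomputable def StaircaseData.M (S : StaircaseData) (C D : ∀ m, Set (Perm m)) :
    ℕ → ℕ → ∀ m, Set (Perm m) :=
  fun k ℓ => if ∃ i, S.pos (2 * i) = (k, ℓ) then C
    else if ∃ i, S.pos (2 * i + 1) = (k, ℓ) then D else emptyCell

open Classical in
/-- The matrix of the `t`-step restriction of the staircase: only the first `2t` cells. -/
noncomputable def StaircaseData.Mstep (S : StaircaseData) (C D : ∀ m, Set (Perm m)) (t : ℕ) :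
    ℕ → ℕ → ∀ m, Set (Perm m) :=
  fun k ℓ => if ∃ i < t, S.pos (2 * i) = (k, ℓ) then C
    else if ∃ i < t, S.pos (2 * i + 1) = (k, ℓ) then D else emptyCell

/-- The entries of `π` of any one colour form an increasing sequence. -/
def IncColoring {n : ℕ} {α : Type*} (π : Perm n) (col : Fin n → α) : Prop :=
  ∀ i j, i < j → col i = col j → π i < π j

theorem IncColoring.mem_avSet {n m : ℕ} {π : Perm n} {col : Fin n → Fin m}
    (h : IncColoring π col) : π ∈ avSet (delta (m + 1)) n := by
  rintro ⟨f, hf⟩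
  obtain ⟨a, b, hab, hc⟩ := Fintype.exists_ne_map_eq_of_card_lt (fun a => col (f a)) (by simp)
  wlog hlt : a < b generalizing a b
  · exact this b a hab.symm hc.symm (lt_of_le_of_ne (not_lt.1 hlt) hab.symm)
  have h1 := (hf a b).2 (h _ _ (f.strictMono hlt) hc)
  exact absurd (Fin.rev_lt_rev.1 h1) hlt.not_gt

theorem exists_incColoring {n m : ℕ} {π : Perm n} (h : π ∈ avSet (delta (m + 1)) n) :
    ∃ col : Fin n → Fin m, IncColoring π col := by
  let F : Fin n → Fin n × (Fin n)ᵒᵈ := fun i => (i, OrderDual.toDual (π i))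
  let G : Fin n → Set.range F := fun i => ⟨F i, i, rfl⟩
  have key : ∀ i, Order.height (G i) < m := by
    intro i
    by_contra! hi
    obtain ⟨p, -, hp⟩ := Order.exists_series_of_le_height (G i) hi
    subst hp
    have hs : ∀ a b, a < b → (p a).1.1 < (p b).1.1 ∧ π (p b).1.1 < π (p a).1.1 := by
      intro a b hab
      have hlt : p a < p b := p.strictMono hab
      generalize p a = x at *
      generalize p b = y at *
      obtain ⟨_, x, rfl⟩ := x
      obtain ⟨_, y, rfl⟩ := y
      have hle : x ≤ y ∧ π y ≤ π x := hlt.le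
      have hne : x ≠ y := by rintro rfl; exact lt_irrefl _ hlt
      exact ⟨lt_of_le_of_ne hle.1 hne, lt_of_le_of_ne hle.2 (fun e => hne (π.injective e.symm))⟩
    refine h ⟨OrderEmbedding.ofStrictMono (fun a => (p a).1.1) fun a b hab => (hs a b hab).1, ?_⟩
    intro a b
    change Fin.rev a < Fin.rev b ↔ π (p a).1.1 < π (p b).1.1
    rw [Fin.rev_lt_rev]
    refine ⟨fun hab => (hs _ _ hab).2, fun hab => ?_⟩
    rcases lt_trichotomy a b with h1 | h1 | h1
    · exact absurd (hs _ _ h1).2 hab.not_gt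
    · subst h1; exact absurd hab (lt_irrefl _)
    · exact h1
  have hlift : ∀ i, ∃ c : Fin m, Order.height (G i) = (c : ℕ) := fun i => by
    obtain ⟨c, hc⟩ := ENat.ne_top_iff_exists.1 (ne_top_of_lt (key i))
    exact ⟨⟨c, by have := key i; rw [← hc] at this; exact_mod_cast this⟩, hc.symm⟩
  choose col hcol using hlift
  refine ⟨col, fun i j hij hc => ?_⟩
  by_contra! hle
  have hlt : G i < G j := lt_of_le_of_ne ⟨hij.le, hle⟩ (fun e => by
    have := congrArg (fun x => x.1.1) e
    exact hij.ne this)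
  have := Order.height_strictMono hlt ((key i).trans_le le_top)
  rw [hcol, hcol, hc] at this
  exact lt_irrefl _ this

/-- A bijection that preserves the fibres of `u` and is increasing on each of them is trivial. -/
theorem perm_eq_one_of_fiberwise_mono {α β : Type*} [LinearOrder α] [WellFoundedLT α] (u : α → β)
    (ρ : Equiv.Perm α) (hu : ∀ a, u (ρ a) = u a)
    (hmono : ∀ a b, a < b → u a = u b → ρ a < ρ b) : ρ = 1 := by
  have main : ∀ τ : Equiv.Perm α, (∀ a, u (τ a) = u a) →
      (∀ a b, a < b → u a = u b → τ a < τ b) → ∀ a, a ≤ τ a := by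
    intro τ h1 h2 a
    let φ : {b // u b = u a} → {b // u b = u a} := fun b => ⟨τ b, (h1 b).trans b.2⟩
    have hφ : StrictMono φ := fun b c hbc => h2 _ _ hbc (b.2.trans c.2.symm)
    exact hφ.le_apply (x := ⟨a, rfl⟩)
  have hu' : ∀ a, u (ρ.symm a) = u a := fun a => by rw [← hu, ρ.apply_symm_apply]
  have hm' : ∀ a b, a < b → u a = u b → ρ.symm a < ρ.symm b := by
    intro a b hab he
    by_contra! hle
    rcases hle.eq_or_lt with h | h
    · exact hab.ne (ρ.symm.injective h.symm)
    · have := hmono _ _ h (by rw [hu', hu', he])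
      simp only [Equiv.apply_symm_apply] at this
      exact hab.not_gt this
  ext a
  refine le_antisymm ?_ (main ρ hu hmono a)
  simpa using main ρ.symm hu' hm' (ρ a)

theorem IncColoring.eq_of_eq {n : ℕ} {α : Type*} {π π' : Perm n} {u u' : Fin n → α}
    (h : IncColoring π u) (h' : IncColoring π' u') (hu : u = u')
    (hv : u ∘ π.symm = u' ∘ π'.symm) : π = π' := by
  subst hu
  have hv' : ∀ a, u (π'.symm (π a)) = u a := fun a => by
    simpa using (congrFun hv (π a)).symm
  have := perm_eq_one_of_fiberwise_mono u (π.trans π'.symm) hv' (by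
    intro a b hab he
    have h1 := h a b hab he
    simp only [Equiv.trans_apply]
    by_contra! hle
    rcases hle.eq_or_lt with h2 | h2
    · exact h1.ne (π'.symm.injective h2.symm)
    · have := h' _ _ h2 (by rw [hv', hv', he])
      simp only [Equiv.apply_symm_apply] at this
      exact h1.not_gt this)
  ext a
  have h3 := congrArg (fun ρ => π' (ρ a)) this
  simp at h3
  rw [h3]

theorem ncard_avSet_delta_le (m n : ℕ) :
    (avSet (delta (m + 1)) n).ncard ≤ (m ^ n) ^ 2 := by
  choose col hcol using fun π : avSet (delta (m + 1)) n => exists_incColoring π.2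
  rw [← Nat.card_coe_set_eq]
  refine (Nat.card_le_card_of_injective (fun π => (col π, col π ∘ π.1.symm)) ?_).trans
    (le_of_eq (by simp [sq]))
  intro π π' he
  exact Subtype.ext
    ((hcol π).eq_of_eq (hcol π') (congrArg Prod.fst he) (congrArg Prod.snd he))

theorem ncard_avSet_delta_succ_le (m n : ℕ) :
    (avSet (delta (m + 2)) n).ncard ≤ (avSet (delta (m + 2)) (n + 1)).ncard := by
  refine Set.ncard_le_ncard_of_injOn (fun π => dsum π (1 : Perm 1)) ?_ ?_ (Set.toFinite _)
  · intro π h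
    obtain ⟨col, hcol⟩ := exists_incColoring h
    refine IncColoring.mem_avSet (col := Fin.addCases col fun _ => 0) ?_
    intro i j hij he
    induction i using Fin.addCases with
    | left i =>
      induction j using Fin.addCases with
      | left j =>
        have : Fin.castAdd 1 (π i) < Fin.castAdd 1 (π j) := hcol i j hij (by simpa using he)
        simpa [dsum] using this
      | right j => simp [dsum, Fin.lt_def]
    | right i =>
      induction j using Fin.addCases with
      | left j => exfalso; simp [Fin.lt_def] at hij; omega
      | right j => exact absurd hij (by rw [Subsingleton.elim i j]; exact lt_irrefl _)
  · intro π _ π' _ he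
    ext i
    have := congrArg (fun σ => (σ (Fin.castAdd 1 i) : ℕ)) he
    simpa [dsum] using this

/-- A permutation has at most one colouring with increasing colour classes in which every entry of
nonzero colour has an entry of the preceding colour before and above it. -/
theorem greedyColoring_unique {n : ℕ} {π : Perm n} {u v : Fin n → ℕ}
    (hu : IncColoring π u) (hu' : ∀ j c, u j = c + 1 → ∃ i < j, π j < π i ∧ u i = c)
    (hv : IncColoring π v) (hv' : ∀ j c, v j = c + 1 → ∃ i < j, π j < π i ∧ v i = c) : u = v := by
  have main : ∀ u v : Fin n → ℕ, (∀ j c, u j = c + 1 → ∃ i < j, π j < π i ∧ u i = c) →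
      IncColoring π v → (∀ j c, v j = c + 1 → ∃ i < j, π j < π i ∧ v i = c) → ∀ i, u i ≤ v i := by
    intro u v hu' hv hv'
    have chain : ∀ d i c, v i = c + d → ∃ k ≤ i, π i ≤ π k ∧ v k = c := by
      intro d
      induction d with
      | zero => exact fun i c h => ⟨i, le_rfl, le_rfl, h⟩
      | succ d ih =>
        intro i c h
        obtain ⟨k, hk, hk', e⟩ := hv' i (c + d) (by omega)
        obtain ⟨l, hl, hl', e'⟩ := ih k c e
        exact ⟨l, hl.trans hk.le, hk'.le.trans hl', e'⟩
    have mono : ∀ i j, i < j → π j < π i → v i < v j := by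
      intro i j hij hp
      by_contra! hle
      obtain ⟨k, hk, hk', e⟩ := chain (v i - v j) i (v j) (by omega)
      exact absurd (hv k j (hk.trans_lt hij) e) (hp.trans_le hk').not_gt
    have : ∀ c i, u i = c → c ≤ v i := by
      intro c
      induction c with
      | zero => exact fun _ _ => Nat.zero_le _
      | succ c ih =>
        intro j h
        obtain ⟨i, hi, hp, e⟩ := hu' j c h
        exact (ih i e).trans_lt (mono i j hi hp)
    exact fun i => this _ i rfl
  exact funext fun i => le_antisymm (main u v hu' hv hv' i) (main v u hv' hu hu' i)

theorem exists_rank {α β : Type*} [Fintype α] [LinearOrder β] {n : ℕ} (hn : Fintype.card α = n)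
    (K : α → β) (hK : Function.Injective K) :
    ∃ e : α ≃ Fin n, ∀ a b, e a < e b ↔ K a < K b := by
  let _ := LinearOrder.lift' K hK
  exact ⟨(monoEquivOfFin α hn).symm.toEquiv, fun a b => (monoEquivOfFin α hn).symm.lt_iff_lt⟩

theorem equiv_fin_eq_of_lt_iff {α : Type*} {n : ℕ} (e e' : α ≃ Fin n)
    (h : ∀ a b, e a < e b ↔ e' a < e' b) : e = e' := by
  let o : Fin n ≃o Fin n := (e.symm.trans e').toOrderIso
    (StrictMono.monotone fun a b hab => (h _ _).1 (by simpa using hab))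
    (StrictMono.monotone fun a b hab => (h _ _).2 (by simpa using hab))
  ext a
  have := congrArg (fun f : Fin n ≃o Fin n => f (e a)) (Subsingleton.elim o (OrderIso.refl _))
  simp [o] at this
  rw [this]

/-- Balanced arrangements: shuffles of `m` increasing runs of length `s`. -/
abbrev Shuffle (m s : ℕ) :=
  {e : Fin m × Fin s ≃ Fin (m * s) // ∀ c, StrictMono fun r => e (c, r)}

theorem factorial_le_card_shuffle (m s : ℕ) :
    (m * s).factorial ≤ Fintype.card (Shuffle m s) * s.factorial ^ m := by
  classical
  let Φ : Shuffle m s × (Fin m → Equiv.Perm (Fin s)) → (Fin m × Fin s ≃ Fin (m * s)) :=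
    fun x => (Equiv.prodShear (Equiv.refl _) x.2).symm.trans x.1.1
  have hΦ : Function.Surjective Φ := by
    intro f
    let τ : Fin m → Equiv.Perm (Fin s) := fun c => Tuple.sort fun r => f (c, r)
    refine ⟨(⟨(Equiv.prodShear (Equiv.refl _) τ).trans f, fun c => ?_⟩, τ), ?_⟩
    · refine Monotone.strictMono_of_injective (Tuple.monotone_sort fun r => f (c, r)) ?_
      intro a b hab
      simpa using hab
    · ext x
      simp [Φ]
  have := Fintype.card_le_of_surjective Φ hΦ
  rw [Fintype.card_equiv finProdFinEquiv] at this
  simpa [Fintype.card_perm] using this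

theorem pow_mul_factorial_pow_le (m t : ℕ) :
    m ^ (m * t) * (t + 1).factorial ^ m ≤ (m * (t + 1)).factorial * (t + 1) ^ m := by
  induction t with
  | zero => simp [Nat.one_le_iff_ne_zero, Nat.factorial_ne_zero]
  | succ t ih =>
    have h1 : (m * (t + 1)).factorial * (m * (t + 1)) ^ m ≤ (m * (t + 1 + 1)).factorial := by
      calc _ ≤ (m * (t + 1)).factorial * (m * (t + 1) + 1) ^ m := by gcongr; omega
        _ ≤ (m * (t + 1) + m).factorial := Nat.factorial_mul_pow_le_factorial
        _ = _ := by rw [Nat.mul_succ m (t + 1)]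
    calc m ^ (m * (t + 1)) * (t + 1 + 1).factorial ^ m
        = m ^ m * (t + 1 + 1) ^ m * (m ^ (m * t) * (t + 1).factorial ^ m) := by
          rw [Nat.factorial_succ (t + 1), mul_pow, Nat.mul_succ, pow_add]; ring
      _ ≤ m ^ m * (t + 1 + 1) ^ m * ((m * (t + 1)).factorial * (t + 1) ^ m) := by gcongr
      _ = ((m * (t + 1)).factorial * (m * (t + 1)) ^ m) * (t + 1 + 1) ^ m := by
          rw [mul_pow]; ring
      _ ≤ _ := by gcongr

theorem pow_le_card_shuffle (m t : ℕ) :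
    m ^ (m * t) ≤ Fintype.card (Shuffle m (t + 1)) * (t + 1) ^ m := by
  have h := (pow_mul_factorial_pow_le m t).trans
    (Nat.mul_le_mul_right _ (factorial_le_card_shuffle m (t + 1)))
  refine Nat.le_of_mul_le_mul_right (c := (t + 1).factorial ^ m) ?_ (by positivity)
  linarith

theorem card_stair (μ T s : ℕ) :
    Fintype.card (Fin (μ + 1) × Fin (T + μ) × Fin s) = (μ + 1) * ((T + μ) * s) := by
  simp

section staircase

variable {μ T s : ℕ} [NeZero T]

/-- The sort key that places the `q`-th chunk of colour `c` into block `q + h c`, the entries of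
block `μ + t` being arranged according to `g t`. -/
def stairKey (h : Fin (μ + 1) → ℕ) (g : Fin T → Shuffle (μ + 1) s)
    (x : Fin (μ + 1) × Fin (T + μ) × Fin s) : ℕ ×ₗ Fin ((μ + 1) * s) :=
  toLex (x.2.1 + h x.1, (g (Fin.ofNat T (x.2.1 + h x.1 - μ))).1 (x.1, x.2.2))

theorem stairKey_injective (h : Fin (μ + 1) → ℕ) (g : Fin T → Shuffle (μ + 1) s) :
    Function.Injective (stairKey h g) := by
  rintro ⟨c, q, r⟩ ⟨c', q', r'⟩ e
  have e1 : (q : ℕ) + h c = q' + h c' := congrArg (fun z => (ofLex z).1) e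
  have e2 := congrArg (fun z => (ofLex z).2) e
  simp only [stairKey, ofLex_toLex, e1] at e2
  have e3 := (g _).1.injective e2
  simp only [Prod.mk.injEq] at e3
  obtain ⟨rfl, rfl⟩ := e3
  have : q = q' := Fin.ext (by omega)
  rw [this]

theorem stairKey_mono (h : Fin (μ + 1) → ℕ) (g : Fin T → Shuffle (μ + 1) s) (c : Fin (μ + 1))
    {y z : Fin (T + μ) × Fin s} (hyz : toLex y < toLex z) :
    stairKey h g (c, y) < stairKey h g (c, z) := by
  obtain ⟨q, r⟩ := y
  obtain ⟨q', r'⟩ := z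
  rw [Prod.Lex.toLex_lt_toLex] at hyz
  simp only [stairKey, Prod.Lex.toLex_lt_toLex]
  rcases hyz with hq | ⟨rfl, hr⟩
  · left
    have : (q : ℕ) < q' := hq
    simpa using this
  · exact Or.inr ⟨rfl, (g _).2 c hr⟩

theorem stairKey_recover (h : Fin (μ + 1) → ℕ) (hh : ∀ c, h c ≤ μ)
    (g g' : Fin T → Shuffle (μ + 1) s)
    (hgg : ∀ x y, stairKey h g x < stairKey h g y ↔ stairKey h g' x < stairKey h g' y) :
    g = g' := by
  funext t
  refine Subtype.ext (equiv_fin_eq_of_lt_iff _ _ ?_)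
  rintro ⟨c, r⟩ ⟨c', r'⟩
  have hlt : ∀ c, μ + t - h c < T + μ := fun c => by omega
  have := hgg (c, ⟨μ + t - h c, hlt c⟩, r) (c', ⟨μ + t - h c', hlt c'⟩, r')
  have e : ∀ c, μ + t - h c + h c = μ + t := fun c => by have := hh c; omega
  simpa [stairKey, Prod.Lex.toLex_lt_toLex, e] using this

variable (h : Fin (μ + 1) → ℕ) (g : Fin T → Shuffle (μ + 1) s)

/-- The ranks of the entries with respect to `stairKey`. -/
noncomputable def stairRank :
    Fin (μ + 1) × Fin (T + μ) × Fin s ≃ Fin ((μ + 1) * ((T + μ) * s)) :=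
  (exists_rank (card_stair μ T s) _ (stairKey_injective h g)).choose

theorem stairRank_lt (x y) : stairRank h g x < stairRank h g y ↔ stairKey h g x < stairKey h g y :=
  (exists_rank (card_stair μ T s) _ (stairKey_injective h g)).choose_spec x y

/-- The permutation of a pair of families of shuffles, one arranging the positions
and the other the values. -/
noncomputable def stairPerm (g g' : Fin T → Shuffle (μ + 1) s) :
    Perm ((μ + 1) * ((T + μ) * s)) :=
  (stairRank (fun c => c) g).symm.trans (stairRank (fun c => μ - c) g')

theorem stairRank_lt_iff (c) (y z) :
    stairRank h g (c, y) < stairRank h g (c, z) ↔ toLex y < toLex z := by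
  rw [stairRank_lt]
  refine ⟨fun hlt => ?_, stairKey_mono _ _ _⟩
  by_contra! hle
  rcases hle.eq_or_lt with h1 | h1
  · rw [toLex.injective h1] at hlt
    exact lt_irrefl _ hlt
  · exact hlt.not_gt (stairKey_mono _ _ _ h1)

theorem stairPerm_incColoring (g g' : Fin T → Shuffle (μ + 1) s) :
    IncColoring (stairPerm g g') fun i => ((stairRank (fun c => c) g).symm i).1 := by
  intro i j hij he
  obtain ⟨⟨c, y⟩, rfl⟩ := (stairRank (fun c => c) g).surjective i
  obtain ⟨⟨c', z⟩, rfl⟩ := (stairRank (fun c => c) g).surjective j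
  simp only [Equiv.symm_apply_apply] at he
  subst he
  simp only [stairPerm, Equiv.trans_apply, Equiv.symm_apply_apply]
  rw [stairRank_lt_iff] at hij ⊢
  exact hij

theorem stairPerm_greedy (g g' : Fin T → Shuffle (μ + 1) s) (j) (c : ℕ)
    (hc : (((stairRank (fun c => c) g).symm j).1 : ℕ) = c + 1) :
    ∃ i < j, stairPerm g g' j < stairPerm g g' i ∧
      (((stairRank (fun c => c) g).symm i).1 : ℕ) = c := by
  obtain ⟨⟨d, q, r⟩, rfl⟩ := (stairRank (fun c => c) g).surjective j
  simp only [Equiv.symm_apply_apply] at hc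
  have hd := d.2
  refine ⟨stairRank (fun c => c) g (⟨c, by omega⟩, q, r), ?_, ?_, by simp⟩
  · rw [stairRank_lt, stairKey, stairKey, Prod.Lex.toLex_lt_toLex]
    left
    simp only
    omega
  · simp only [stairPerm, Equiv.trans_apply, Equiv.symm_apply_apply]
    rw [stairRank_lt, stairKey, stairKey, Prod.Lex.toLex_lt_toLex]
    left
    simp only
    omega

theorem stairPerm_injective :
    Function.Injective fun x : (Fin T → Shuffle (μ + 1) s) × (Fin T → Shuffle (μ + 1) s) =>
      stairPerm x.1 x.2 := by
  rintro ⟨g₁, g₁'⟩ ⟨g₂, g₂'⟩ he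
  simp only at he
  have hcol : (fun i => (((stairRank (fun c => c) g₁).symm i).1 : ℕ)) =
      fun i => (((stairRank (fun c => c) g₂).symm i).1 : ℕ) := by
    refine greedyColoring_unique (π := stairPerm g₁ g₁') ?_ (stairPerm_greedy g₁ g₁') ?_ ?_
    · exact fun i j hij e => stairPerm_incColoring g₁ g₁' i j hij (Fin.ext e)
    · rw [he]
      exact fun i j hij e => stairPerm_incColoring g₂ g₂' i j hij (Fin.ext e)
    · rw [he]
      exact stairPerm_greedy g₂ g₂'
  have hrank : stairRank (fun c => c) g₁ = stairRank (fun c => c) g₂ := by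
    set P₁ := stairRank (fun c => c) g₁ with hP₁
    set P₂ := stairRank (fun c => c) g₂ with hP₂
    have hfst : ∀ i, (P₁.symm i).1 = (P₂.symm i).1 := fun i => Fin.ext (congrFun hcol i)
    have := perm_eq_one_of_fiberwise_mono (fun i => (P₁.symm i).1) (P₁.symm.trans P₂)
      (fun i => by simp [hfst]) (by
        intro i j hij e
        obtain ⟨⟨c, y⟩, rfl⟩ := P₁.surjective i
        obtain ⟨⟨c', z⟩, rfl⟩ := P₁.surjective j
        simp only [Equiv.symm_apply_apply] at e
        subst e
        simp only [Equiv.trans_apply, Equiv.symm_apply_apply]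
        rw [hP₁, stairRank_lt_iff] at hij
        rwa [hP₂, stairRank_lt_iff])
    refine Equiv.ext fun x => ?_
    simpa using (congrArg (fun ρ => ρ (P₁ x)) this).symm
  have hg : g₁ = g₂ := stairKey_recover (fun c => (c : ℕ)) (fun c => by omega) _ _ fun x y => by
    rw [← stairRank_lt, ← stairRank_lt, hrank]
  have hrank' : stairRank (fun c => μ - c) g₁' = stairRank (fun c => μ - c) g₂' := by
    ext x
    have := congrArg (fun σ => (σ (stairRank (fun c => c) g₁ x) : ℕ)) he
    simp only [stairPerm, Equiv.trans_apply] at this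
    rw [← hrank] at this
    simpa using this
  have hg' : g₁' = g₂' :=
    stairKey_recover (fun c => (μ - c : ℕ)) (fun c => by omega) _ _ fun x y => by
      rw [← stairRank_lt, ← stairRank_lt, hrank']
  rw [hg, hg']

theorem card_shuffle_pow_le (μ T s : ℕ) [NeZero T] :
    (Fintype.card (Shuffle (μ + 1) s) ^ T) ^ 2 ≤
      (avSet (delta (μ + 2)) ((μ + 1) * ((T + μ) * s))).ncard := by
  classical
  have h := Set.ncard_le_ncard_of_injOn (s := Set.univ)
    (t := avSet (delta (μ + 2)) ((μ + 1) * ((T + μ) * s)))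
    (fun x : (Fin T → Shuffle (μ + 1) s) × (Fin T → Shuffle (μ + 1) s) => stairPerm x.1 x.2)
    (fun x _ => (stairPerm_incColoring x.1 x.2).mem_avSet) stairPerm_injective.injOn
    (Set.toFinite _)
  refine le_trans (le_of_eq ?_) h
  rw [Set.ncard_univ, Nat.card_eq_fintype_card]
  simp [sq]

end staircase

theorem tendsto_rate (ℓ C : ℝ) : Tendsto (fun s : ℕ => 2 * ((s : ℝ) / (s + C)) *
    ((s - 1) / (s + C) * ℓ - Real.log s / (s + C))) atTop (𝓝 (2 * ℓ)) := by
  have hdiv : ∀ a : ℝ, Tendsto (fun s : ℕ => a / ((s : ℝ) + C)) atTop (𝓝 0) := fun a =>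
    tendsto_const_nhds.div_atTop (tendsto_atTop_add_const_right _ _ tendsto_natCast_atTop_atTop)
  have hne : ∀ᶠ s : ℕ in atTop, (s : ℝ) + C ≠ 0 :=
    ((tendsto_atTop_add_const_right _ C tendsto_natCast_atTop_atTop).eventually_gt_atTop 0).mono
      fun _ h => ne_of_gt h
  have h1 : ∀ a : ℝ, Tendsto (fun s : ℕ => ((s : ℝ) - a) / (s + C)) atTop (𝓝 1) := by
    intro a
    have := (hdiv (a + C)).const_sub 1
    rw [sub_zero] at this
    refine this.congr' (hne.mono fun s hs => ?_)
    field_simp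
    ring
  have h2 : Tendsto (fun s : ℕ => Real.log s / (s + C)) atTop (𝓝 0) := by
    have hlog : Tendsto (fun s : ℕ => Real.log s / s) atTop (𝓝 0) :=
      (Real.isLittleO_log_id_atTop.tendsto_div_nhds_zero).comp tendsto_natCast_atTop_atTop
    have := hlog.mul (h1 0)
    rw [zero_mul] at this
    refine this.congr' ?_
    filter_upwards [eventually_gt_atTop 0] with s hs
    have : (s : ℝ) ≠ 0 := by positivity
    rw [sub_zero, div_mul_div_cancel₀ this]
  have h0 := h1 0
  simp only [sub_zero] at h0
  have := (h0.const_mul 2).mul (((h1 1).mul_const ℓ).sub h2)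
  simpa using this

theorem ncard_avSet_delta_lower (μ n t : ℕ) (hn : (μ + 1) * ((t + 1) * (t + 1 + μ)) ≤ n) :
    ((μ : ℝ) + 1) ^ ((μ + 1) * t * (2 * (t + 1))) ≤
      (avSet (delta (μ + 2)) n).ncard * ((t : ℝ) + 1) ^ ((μ + 1) * (2 * (t + 1))) := by
  have h1 := card_shuffle_pow_le μ (t + 1) (t + 1)
  have h2 := monotone_nat_of_le_succ (ncard_avSet_delta_succ_le μ)
    (show (μ + 1) * ((t + 1 + μ) * (t + 1)) ≤ n by rwa [mul_comm (t + 1 + μ)])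
  have h3 := Nat.pow_le_pow_left (pow_le_card_shuffle (μ + 1) t) (2 * (t + 1))
  rw [← pow_mul, mul_pow, ← pow_mul] at h3
  rw [← pow_mul, mul_comm (t + 1) 2] at h1
  exact_mod_cast h3.trans (Nat.mul_le_mul_right _ (h1.trans h2))

theorem growthSeq_delta_lower (μ n s : ℕ) (hs : 0 < s) (hn : (μ + 1) * (s * (s + μ)) ≤ n)
    (hn' : n ≤ (μ + 1) * (s + μ + 1) ^ 2) :
    Real.exp (2 * ((s : ℝ) / (s + ((μ : ℝ) + 1))) * ((s - 1) / (s + ((μ : ℝ) + 1)) *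
      Real.log ((μ : ℝ) + 1) - Real.log s / (s + ((μ : ℝ) + 1)))) ≤
      growthSeq (avSet (delta (μ + 2))) n := by
  obtain ⟨t, rfl⟩ := Nat.exists_eq_succ_of_ne_zero hs.ne'
  have h := ncard_avSet_delta_lower μ n t hn
  have hnpos : (0 : ℝ) < n := by
    have : 0 < n := lt_of_lt_of_le (by positivity) hn
    exact_mod_cast this
  rw [growthSeq]
  generalize (avSet (delta (μ + 2)) n).ncard = a at h ⊢
  have ha : 0 < a := by
    rcases Nat.eq_zero_or_pos a with rfl | h'
    · exact absurd h (not_le.2 (by simp; positivity))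
    · exact h'
  have ha' : (0 : ℝ) < a := by exact_mod_cast ha
  have hlog := Real.log_le_log (by positivity) h
  rw [Real.log_mul (by positivity) (by positivity), Real.log_pow, Real.log_pow] at hlog
  rw [Real.rpow_def_of_pos ha', Real.exp_le_exp, ← div_eq_mul_inv]
  have ha0 : 0 ≤ Real.log a := Real.log_nonneg (by exact_mod_cast ha)
  have hbound : (n : ℝ) ≤ ((μ : ℝ) + 1) * (t + 1 + (μ + 1)) ^ 2 := by
    have : (n : ℝ) ≤ ((μ : ℝ) + 1) * (((t + 1 : ℕ) : ℝ) + μ + 1) ^ 2 := by exact_mod_cast hn'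
    push_cast at this
    rwa [← add_assoc]
  refine le_trans ?_ (div_le_div_of_nonneg_left ha0 hnpos hbound)
  rw [le_div_iff₀ (by positivity)]
  push_cast at hlog ⊢
  have hD : (t : ℝ) + 1 + (μ + 1) ≠ 0 := by positivity
  refine le_trans (le_of_eq ?_) (sub_le_iff_le_add.2 hlog)
  field_simp
  ring

theorem growthSeq_delta_upper (m n : ℕ) (hn : 0 < n) :
    growthSeq (avSet (delta (m + 1))) n ≤ (m : ℝ) ^ 2 := by
  have h : ((avSet (delta (m + 1)) n).ncard : ℝ) ≤ ((m : ℝ) ^ 2) ^ n := by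
    rw [← pow_mul, mul_comm 2 n, pow_mul]
    exact_mod_cast ncard_avSet_delta_le m n
  calc growthSeq (avSet (delta (m + 1))) n ≤ (((m : ℝ) ^ 2) ^ n) ^ ((n : ℝ)⁻¹) :=
        Real.rpow_le_rpow (by positivity) h (by positivity)
    _ = _ := Real.pow_rpow_inv_natCast (by positivity) hn.ne'

/-- For `k ≥ 1`, the class `Av(k⋯21)` has proper growth rate `(k-1)²`. -/
theorem av_delta_growth (k : ℕ) (hk : 1 ≤ k) :
    HasGrowth (avSet (delta k)) (((k : ℝ) - 1) ^ 2) := by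
  obtain ⟨m, rfl⟩ := Nat.exists_eq_add_of_le' hk
  have hupper : ∀ᶠ n in atTop, growthSeq (avSet (delta (m + 1))) n ≤ (m : ℝ) ^ 2 :=
    (eventually_gt_atTop 0).mono fun n hn => growthSeq_delta_upper m n hn
  rw [Nat.cast_add_one, add_sub_cancel_right, HasGrowth]
  rcases m with _ | μ
  · refine tendsto_of_tendsto_of_tendsto_of_le_of_le' tendsto_const_nhds tendsto_const_nhds
      (Eventually.of_forall fun n => ?_) hupper
    simp only [Nat.cast_zero, ne_eq, OfNat.ofNat_ne_zero, not_false_eq_true, zero_pow]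
    exact Real.rpow_nonneg (by positivity) _
  · have hsqrt : Tendsto (fun n : ℕ => Nat.sqrt (n / (μ + 1))) atTop atTop := by
      refine tendsto_atTop.2 fun b => ?_
      filter_upwards [eventually_ge_atTop (b * b * (μ + 1))] with n hn
      rw [Nat.le_sqrt, Nat.le_div_iff_mul_le (by positivity)]
      exact hn
    have hlim := (Real.continuous_exp.tendsto _).comp
      ((tendsto_rate (Real.log ((μ : ℝ) + 1)) ((μ : ℝ) + 1)).comp
        ((tendsto_sub_atTop_nat μ).comp hsqrt))
    have hval : Real.exp (2 * Real.log ((μ : ℝ) + 1)) = ((μ + 1 : ℕ) : ℝ) ^ 2 := by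
      rw [two_mul, Real.exp_add, Real.exp_log (by positivity)]
      push_cast
      ring
    rw [hval] at hlim
    refine tendsto_of_tendsto_of_tendsto_of_le_of_le' hlim tendsto_const_nhds ?_ hupper
    filter_upwards [hsqrt.eventually_gt_atTop μ] with n hn
    set w := Nat.sqrt (n / (μ + 1)) with hw
    obtain ⟨s, hs⟩ := Nat.exists_eq_add_of_le hn.le
    have hsub : w - μ = s := by omega
    simp only [Function.comp_apply, ← hw, hsub]
    have hle : w * w ≤ n / (μ + 1) := Nat.sqrt_le _
    have hlt : n / (μ + 1) < (w + 1) * (w + 1) := Nat.lt_succ_sqrt _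
    refine growthSeq_delta_lower μ n s (by omega) ?_ ?_
    · rw [Nat.le_div_iff_mul_le (by positivity)] at hle
      refine le_trans ?_ hle
      rw [mul_comm, hs, add_comm μ s]
      gcongr
      omega
    · rw [Nat.div_lt_iff_lt_mul (by positivity)] at hlt
      refine hlt.le.trans (le_of_eq ?_)
      rw [hs]
      ring
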